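/- Let Markov-parameter data S_{q,q0,j}(w), S_{f,q}(w) for an index set Φ over a finite mode set Q be given, and suppose for some N > 0 that rank H_{Φ,N,N} = rank H_{Φ,N+1,N} = rank H_{Φ,N,N+1}. Then: (1) a minimal (2N+1)-partial LSS realization of the Markov data exists; (2) every minimal (2N+1)-partial realization has dimension rank H_{Φ,N,N}; (3) any two minimal (2N+1)-partial realizations are LSS-isomorphic. -/

import Mathlib

open Matrix

section LssDefs

variable {Q Φ : Type*} {p m : ℕ}

/-- `A_w = A_{q_k} ⋯ A_{q_1}` for the word `w = q_1 ⋯ q_k`. -/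
def wordProd {Q : Type*} {n : ℕ} (A : Q → Matrix (Fin n) (Fin n) ℝ) :
    List Q → Matrix (Fin n) (Fin n) ℝ
  | [] => 1
  | q :: w => wordProd A w * A q

/-- Entry data of the Hankel matrix of the Markov-parameter data `(S1, S2)`:
`S1 q q0 z w = S_{q,q0,z}(w)` and `S2 f q w = S_{f,q}(w)`.  The column index `j` ranges
over `J_Φ = Φ ⊕ (Q × {1,…,m})`, the row block is indexed by `q' ∈ Q` (the enumeration of
`{1,…,pD}` as `Q × Fin p`) together with `r ∈ Fin p`. -/
def lssEntry (S1 : Q → Q → Fin m → List Q → Fin p → ℝ)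
    (S2 : Φ → Q → List Q → Fin p → ℝ)
    (j : Φ ⊕ Q × Fin m) (u : List Q) (q' : Q) (r : Fin p) : ℝ :=
  match j with
  | Sum.inl f => S2 f q' u r
  | Sum.inr (q, z) => S1 q' q z u r

/-- Span of the columns of the full Hankel matrix `H_Φ`. -/
def lssFullSpan (S1 : Q → Q → Fin m → List Q → Fin p → ℝ)
    (S2 : Φ → Q → List Q → Fin p → ℝ) : Submodule ℝ (List Q × Q × Fin p → ℝ) :=
  Submodule.span ℝ (Set.range fun wj : List Q × (Φ ⊕ Q × Fin m) =>
    fun vqr : List Q × Q × Fin p =>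
      lssEntry S1 S2 wj.2 (wj.1 ++ vqr.1) vqr.2.1 vqr.2.2)

/-- `rank H_{Φ,L,M}` : dimension of the span of the columns of the sub-Hankel matrix
whose rows are indexed by `(v,i)` with `|v| ≤ L` and whose columns are indexed by
`(w,j)` with `|w| ≤ M`. -/
noncomputable def lssHankelRank (S1 : Q → Q → Fin m → List Q → Fin p → ℝ)
    (S2 : Φ → Q → List Q → Fin p → ℝ) (L M : ℕ) : ℕ :=
  Module.finrank ℝ (Submodule.span ℝ
    (Set.range fun wj : {w : List Q // w.length ≤ M} × (Φ ⊕ Q × Fin m) =>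
      fun vqr : {v : List Q // v.length ≤ L} × Q × Fin p =>
        lssEntry S1 S2 wj.2 (wj.1.1 ++ vqr.1.1) vqr.2.1 vqr.2.2))

/-- `(Σ, μ)` is an `N`-partial LSS realization of the Markov-parameter data. -/
def IsLssPartialRealization (S1 : Q → Q → Fin m → List Q → Fin p → ℝ)
    (S2 : Φ → Q → List Q → Fin p → ℝ) (N : ℕ) {n : ℕ}
    (A : Q → Matrix (Fin n) (Fin n) ℝ) (B : Q → Matrix (Fin n) (Fin m) ℝ)
    (C : Q → Matrix (Fin p) (Fin n) ℝ) (μ : Φ → Fin n → ℝ) : Prop :=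
  ∀ w : List Q, w.length ≤ N →
    (∀ (q q0 : Q) (z : Fin m),
      S1 q q0 z w = (C q).mulVec ((wordProd A w).mulVec (fun i => B q0 i z))) ∧
    (∀ (f : Φ) (q : Q), S2 f q w = (C q).mulVec ((wordProd A w).mulVec (μ f)))

/-- `(Σ, μ)` is a complete LSS realization of the Markov-parameter data. -/
def IsLssRealization (S1 : Q → Q → Fin m → List Q → Fin p → ℝ)
    (S2 : Φ → Q → List Q → Fin p → ℝ) {n : ℕ}
    (A : Q → Matrix (Fin n) (Fin n) ℝ) (B : Q → Matrix (Fin n) (Fin m) ℝ)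
    (C : Q → Matrix (Fin p) (Fin n) ℝ) (μ : Φ → Fin n → ℝ) : Prop :=
  ∀ w : List Q,
    (∀ (q q0 : Q) (z : Fin m),
      S1 q q0 z w = (C q).mulVec ((wordProd A w).mulVec (fun i => B q0 i z))) ∧
    (∀ (f : Φ) (q : Q), S2 f q w = (C q).mulVec ((wordProd A w).mulVec (μ f)))

end LssDefs

/-- `T` is an LSS isomorphism from `(Σ, μ)` to `(Σ', μ')`. -/
def IsLssIso {Q Φ : Type*} {p m n n' : ℕ}
    (A : Q → Matrix (Fin n) (Fin n) ℝ) (B : Q → Matrix (Fin n) (Fin m) ℝ)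
    (C : Q → Matrix (Fin p) (Fin n) ℝ) (μ : Φ → Fin n → ℝ)
    (A' : Q → Matrix (Fin n') (Fin n') ℝ) (B' : Q → Matrix (Fin n') (Fin m) ℝ)
    (C' : Q → Matrix (Fin p) (Fin n') ℝ) (μ' : Φ → Fin n' → ℝ)
    (T : Matrix (Fin n') (Fin n) ℝ) : Prop :=
  Function.Bijective T.mulVec ∧
  (∀ q : Q, T * A q = A' q * T) ∧ (∀ q : Q, B' q = T * B q) ∧
  (∀ q : Q, C' q * T = C q) ∧ (∀ f : Φ, T.mulVec (μ f) = μ' f)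

section LssRealization

variable {Q Φ : Type*} {p m : ℕ}

/-- The column of the Hankel matrix indexed by `(w, j)`, restricted to the rows `(v, i)` with
`|v| ≤ L`. -/
def lssColumn (S1 : Q → Q → Fin m → List Q → Fin p → ℝ) (S2 : Φ → Q → List Q → Fin p → ℝ)
    (L : ℕ) (w : List Q) (j : Φ ⊕ Q × Fin m) : {v : List Q // v.length ≤ L} × Q × Fin p → ℝ :=
  fun vqr => lssEntry S1 S2 j (w ++ vqr.1.1) vqr.2.1 vqr.2.2

/-- The span of the columns `(w, j)` with `|w| ≤ M`, restricted to the rows `(v, i)` with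
`|v| ≤ L`. -/
def lssColumnSpan (S1 : Q → Q → Fin m → List Q → Fin p → ℝ) (S2 : Φ → Q → List Q → Fin p → ℝ)
    (L M : ℕ) : Submodule ℝ ({v : List Q // v.length ≤ L} × Q × Fin p → ℝ) :=
  Submodule.span ℝ (Set.range fun wj : {w : List Q // w.length ≤ M} × (Φ ⊕ Q × Fin m) =>
    lssColumn S1 S2 L wj.1.1 wj.2)

/-- The initial states of an LSS realization, indexed by `J_Φ`. -/
def lssInput {n : ℕ} (B : Q → Matrix (Fin n) (Fin m) ℝ) (μ : Φ → Fin n → ℝ) :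
    Φ ⊕ Q × Fin m → Fin n → ℝ :=
  Sum.elim μ fun qz i => B qz.1 i qz.2

/-- The observability map `x ↦ (C_q A_v x)_r`, `|v| ≤ L`. -/
def lssObs {n : ℕ} (A : Q → Matrix (Fin n) (Fin n) ℝ) (C : Q → Matrix (Fin p) (Fin n) ℝ)
    (L : ℕ) : (Fin n → ℝ) →ₗ[ℝ] ({v : List Q // v.length ≤ L} × Q × Fin p → ℝ) :=
  LinearMap.pi fun vqr =>
    LinearMap.proj vqr.2.2 ∘ₗ (C vqr.2.1).mulVecLin ∘ₗ (wordProd A vqr.1.1).mulVecLin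

/-- The span of the states `A_w x_j`, `|w| ≤ M`. -/
def lssReach {n : ℕ} (A : Q → Matrix (Fin n) (Fin n) ℝ) (B : Q → Matrix (Fin n) (Fin m) ℝ)
    (μ : Φ → Fin n → ℝ) (M : ℕ) : Submodule ℝ (Fin n → ℝ) :=
  Submodule.span ℝ (Set.range fun wj : {w : List Q // w.length ≤ M} × (Φ ⊕ Q × Fin m) =>
    (wordProd A wj.1.1).mulVec (lssInput B μ wj.2))

theorem wordProd_append {n : ℕ} (A : Q → Matrix (Fin n) (Fin n) ℝ) (w v : List Q) :
    wordProd A (w ++ v) = wordProd A v * wordProd A w := by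
  induction w with
  | nil => simp [wordProd]
  | cons q w ih => simp [wordProd, ih, Matrix.mul_assoc]

theorem wordProd_concat_mulVec {n : ℕ} (A : Q → Matrix (Fin n) (Fin n) ℝ) (w : List Q) (q : Q)
    (x : Fin n → ℝ) :
    (wordProd A (w ++ [q])).mulVec x = (A q).mulVec ((wordProd A w).mulVec x) := by
  simp [wordProd_append, wordProd]

variable {S1 : Q → Q → Fin m → List Q → Fin p → ℝ} {S2 : Φ → Q → List Q → Fin p → ℝ}

theorem isLssPartialRealization_iff {N n : ℕ} {A : Q → Matrix (Fin n) (Fin n) ℝ}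
    {B : Q → Matrix (Fin n) (Fin m) ℝ} {C : Q → Matrix (Fin p) (Fin n) ℝ} {μ : Φ → Fin n → ℝ} :
    IsLssPartialRealization S1 S2 N A B C μ ↔
      ∀ w : List Q, w.length ≤ N → ∀ j q,
        lssEntry S1 S2 j w q = (C q).mulVec ((wordProd A w).mulVec (lssInput B μ j)) := by
  refine forall₂_congr fun w _ => ⟨?_, fun h => ⟨fun q q0 z => h (Sum.inr (q0, z)) q,
    fun f q => h (Sum.inl f) q⟩⟩
  rintro ⟨hB, hμ⟩ (f | ⟨q0, z⟩) q
  · exact hμ f q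
  · exact hB q q0 z

theorem lssColumn_mem_lssColumnSpan {L M : ℕ} {w : List Q} (hw : w.length ≤ M)
    (j : Φ ⊕ Q × Fin m) : lssColumn S1 S2 L w j ∈ lssColumnSpan S1 S2 L M :=
  Submodule.subset_span ⟨(⟨w, hw⟩, j), rfl⟩

theorem lssColumnSpan_induction {L M : ℕ}
    {P : Submodule ℝ ({v : List Q // v.length ≤ L} × Q × Fin p → ℝ)}
    (h : ∀ w : List Q, w.length ≤ M → ∀ j, lssColumn S1 S2 L w j ∈ P) :
    lssColumnSpan S1 S2 L M ≤ P :=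
  Submodule.span_le.2 (by rintro _ ⟨⟨⟨w, hw⟩, j⟩, rfl⟩; exact h w hw j)

theorem finite_lssRows [Finite Q] (L : ℕ) :
    Finite ({v : List Q // v.length ≤ L} × Q × Fin p) :=
  have : Finite {v : List Q // v.length ≤ L} := List.finite_length_le Q L
  inferInstance

section Realized

variable {n N : ℕ} {A : Q → Matrix (Fin n) (Fin n) ℝ} {B : Q → Matrix (Fin n) (Fin m) ℝ}
  {C : Q → Matrix (Fin p) (Fin n) ℝ} {μ : Φ → Fin n → ℝ}

theorem IsLssPartialRealization.lssObs_apply {K L : ℕ}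
    (h : IsLssPartialRealization S1 S2 K A B C μ) {w : List Q} (hw : w.length + L ≤ K)
    (j : Φ ⊕ Q × Fin m) :
    lssObs A C L ((wordProd A w).mulVec (lssInput B μ j)) = lssColumn S1 S2 L w j := by
  funext ⟨⟨v, hv⟩, q, r⟩
  have := isLssPartialRealization_iff.1 h (w ++ v) (by simp; omega) j q
  simp [lssColumn, lssObs, this, wordProd_append]

theorem IsLssPartialRealization.map_lssReach {K L M : ℕ}
    (h : IsLssPartialRealization S1 S2 K A B C μ) (hK : M + L ≤ K) :
    (lssReach A B μ M).map (lssObs A C L) = lssColumnSpan S1 S2 L M := by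
  rw [lssReach, lssColumnSpan, Submodule.map_span, ← Set.range_comp]
  congr 2
  funext ⟨⟨w, hw⟩, j⟩
  exact h.lssObs_apply ((Nat.add_le_add_right hw L).trans hK) j

theorem IsLssPartialRealization.lssHankelRank_le {K L M : ℕ}
    (h : IsLssPartialRealization S1 S2 K A B C μ) (hK : M + L ≤ K) :
    lssHankelRank S1 S2 L M ≤ n := by
  change Module.finrank ℝ (lssColumnSpan S1 S2 L M) ≤ n
  rw [← h.map_lssReach hK]
  exact (Submodule.finrank_map_le _ _).trans ((Submodule.finrank_le _).trans (by simp))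

theorem IsLssPartialRealization.lssReach_eq_top {K L M : ℕ}
    (h : IsLssPartialRealization S1 S2 K A B C μ) (hK : M + L ≤ K)
    (hn : n = lssHankelRank S1 S2 L M) : lssReach A B μ M = ⊤ := by
  apply Submodule.eq_top_of_finrank_eq
  apply le_antisymm (Submodule.finrank_le _)
  have := Submodule.finrank_map_le (lssObs A C L) (lssReach A B μ M)
  rw [h.map_lssReach hK] at this
  exact (Module.finrank_fin_fun ℝ).trans_le (hn.trans_le this)

theorem IsLssPartialRealization.range_lssObs {K L M : ℕ}
    (h : IsLssPartialRealization S1 S2 K A B C μ) (hK : M + L ≤ K)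
    (hn : n = lssHankelRank S1 S2 L M) :
    LinearMap.range (lssObs A C L) = lssColumnSpan S1 S2 L M := by
  rw [← h.map_lssReach hK, h.lssReach_eq_top hK hn, Submodule.map_top]

theorem IsLssPartialRealization.lssObs_injective {K L M : ℕ}
    (h : IsLssPartialRealization S1 S2 K A B C μ) (hK : M + L ≤ K)
    (hn : n = lssHankelRank S1 S2 L M) : Function.Injective (lssObs A C L) := by
  have hr := LinearMap.finrank_range_add_finrank_ker (lssObs A C L)
  rw [h.range_lssObs hK hn, Module.finrank_fin_fun] at hr
  change lssHankelRank S1 S2 L M + _ = n at hr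
  exact LinearMap.ker_eq_bot.1 (Submodule.finrank_eq_zero.1 (by omega))

/-- Two realizations of dimension `rank H_{Φ,N,N}` are isomorphic. -/
theorem IsLssPartialRealization.exists_isLssIso {n' : ℕ}
    {A' : Q → Matrix (Fin n') (Fin n') ℝ} {B' : Q → Matrix (Fin n') (Fin m) ℝ}
    {C' : Q → Matrix (Fin p) (Fin n') ℝ} {μ' : Φ → Fin n' → ℝ}
    (h : IsLssPartialRealization S1 S2 (2 * N + 1) A B C μ)
    (h' : IsLssPartialRealization S1 S2 (2 * N + 1) A' B' C' μ')
    (hn : n = lssHankelRank S1 S2 N N) (hn' : n' = lssHankelRank S1 S2 N N) :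
    ∃ T : Matrix (Fin n') (Fin n) ℝ, IsLssIso A B C μ A' B' C' μ' T := by
  have hK : N + N ≤ 2 * N + 1 := by omega
  let e := LinearEquiv.ofInjective _ (h.lssObs_injective hK hn)
  let e' := LinearEquiv.ofInjective _ (h'.lssObs_injective hK hn')
  let t : (Fin n → ℝ) ≃ₗ[ℝ] (Fin n' → ℝ) :=
    e ≪≫ₗ LinearEquiv.ofEq _ _ ((h.range_lssObs hK hn).trans (h'.range_lssObs hK hn').symm)
      ≪≫ₗ e'.symm
  have ht (x : Fin n → ℝ) : lssObs A' C' N (t x) = lssObs A C N x :=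
    congrArg Subtype.val (e'.apply_symm_apply _)
  have htw {w : List Q} (hw : w.length ≤ N + 1) (j : Φ ⊕ Q × Fin m) :
      t ((wordProd A w).mulVec (lssInput B μ j)) =
        (wordProd A' w).mulVec (lssInput B' μ' j) := by
    apply h'.lssObs_injective hK hn'
    rw [ht, h.lssObs_apply (by omega), h'.lssObs_apply (by omega)]
  have htj (j : Φ ⊕ Q × Fin m) : t (lssInput B μ j) = lssInput B' μ' j := by
    simpa [wordProd] using htw (w := []) (by simp) j
  have hT (x : Fin n → ℝ) : (LinearMap.toMatrix' t.toLinearMap).mulVec x = t x :=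
    LinearMap.toMatrix'_mulVec _ _
  refine ⟨LinearMap.toMatrix' t.toLinearMap, ?_, fun q => ?_, fun q => ?_, fun q => ?_,
    fun f => ?_⟩
  · rw [show (LinearMap.toMatrix' t.toLinearMap).mulVec = t from funext hT]
    exact t.bijective
  · have hle : lssReach A B μ N ≤ LinearMap.eqLocus
        (t.toLinearMap ∘ₗ (A q).mulVecLin) ((A' q).mulVecLin ∘ₗ t.toLinearMap) := by
      refine Submodule.span_le.2 ?_
      rintro _ ⟨⟨⟨w, hw⟩, j⟩, rfl⟩
      have := htw (w := w ++ [q]) (by simpa using hw) j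
      rw [wordProd_concat_mulVec, wordProd_concat_mulVec, ← htw (by omega)] at this
      exact this
    rw [h.lssReach_eq_top hK hn] at hle
    refine Matrix.ext_of_mulVec_single fun i => ?_
    rw [← Matrix.mulVec_mulVec, ← Matrix.mulVec_mulVec, hT, hT]
    exact hle (x := Pi.single i 1) trivial
  · ext i z
    rw [← show _ = B' q i z from congrFun (htj (Sum.inr (q, z))) i, ← hT]
    rfl
  · refine Matrix.ext_of_mulVec_single fun i => ?_
    rw [← Matrix.mulVec_mulVec, hT]
    funext r
    simpa [lssObs, wordProd] using congrFun (ht (Pi.single i 1)) (⟨[], by simp⟩, q, r)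
  · rw [hT]
    exact htj (Sum.inl f)

end Realized

/-- A realization on an abstract finite-dimensional state space gives a matrix realization. -/
theorem exists_isLssPartialRealization_of_linearMap {V : Type*} [AddCommGroup V] [Module ℝ V]
    [FiniteDimensional ℝ V] {K : ℕ} (a : Q → V →ₗ[ℝ] V) (c : Q → V →ₗ[ℝ] Fin p → ℝ)
    (b : Φ ⊕ Q × Fin m → V)
    (h : ∀ w : List Q, w.length ≤ K → ∀ j q,
      lssEntry S1 S2 j w q = c q (w.foldl (fun x q => a q x) (b j))) :
    ∃ (A : Q → Matrix (Fin (Module.finrank ℝ V)) (Fin (Module.finrank ℝ V)) ℝ)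
      (B : Q → Matrix (Fin (Module.finrank ℝ V)) (Fin m) ℝ)
      (C : Q → Matrix (Fin p) (Fin (Module.finrank ℝ V)) ℝ)
      (μ : Φ → Fin (Module.finrank ℝ V) → ℝ), IsLssPartialRealization S1 S2 K A B C μ := by
  let e := (Module.finBasis ℝ V).equivFun
  let A : Q → Matrix (Fin (Module.finrank ℝ V)) (Fin (Module.finrank ℝ V)) ℝ := fun q =>
    LinearMap.toMatrix' (e.toLinearMap ∘ₗ a q ∘ₗ e.symm.toLinearMap)
  have hA (w : List Q) (x : V) :
      (wordProd A w).mulVec (e x) = e (w.foldl (fun x q => a q x) x) := by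
    induction w generalizing x with
    | nil => simp [wordProd]
    | cons q w ih =>
      rw [wordProd, ← Matrix.mulVec_mulVec, LinearMap.toMatrix'_mulVec]
      simpa using ih (a q x)
  refine ⟨A, fun q => Matrix.of fun i z => e (b (Sum.inr (q, z))) i,
    fun q => LinearMap.toMatrix' (c q ∘ₗ e.symm.toLinearMap), fun f => e (b (Sum.inl f)),
    isLssPartialRealization_iff.2 fun w hw j q => ?_⟩
  have hj : lssInput (fun q => Matrix.of fun i z => e (b (Sum.inr (q, z))) i)
      (fun f => e (b (Sum.inl f))) j = e (b j) := by
    rcases j with f | ⟨q, z⟩ <;> rfl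
  rw [hj, hA, LinearMap.toMatrix'_mulVec, h w hw]
  simp

/-- Restriction of a column to the rows `(v, i)` with `|v| ≤ L`. -/
def lssRestrict (Q : Type*) (p L : ℕ) :
    ({v : List Q // v.length ≤ L + 1} × Q × Fin p → ℝ) →ₗ[ℝ]
      ({v : List Q // v.length ≤ L} × Q × Fin p → ℝ) :=
  LinearMap.funLeft ℝ ℝ fun vqr => (⟨vqr.1.1, vqr.1.2.trans L.le_succ⟩, vqr.2)

/-- The shift sending a column to its part on the rows `(qv, i)` with `|v| ≤ L`. -/
def lssShift (p L : ℕ) (q : Q) :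
    ({v : List Q // v.length ≤ L + 1} × Q × Fin p → ℝ) →ₗ[ℝ]
      ({v : List Q // v.length ≤ L} × Q × Fin p → ℝ) :=
  LinearMap.funLeft ℝ ℝ fun vqr => (⟨q :: vqr.1.1, Nat.succ_le_succ vqr.1.2⟩, vqr.2)

theorem lssRestrict_lssColumn (L : ℕ) (w : List Q) (j : Φ ⊕ Q × Fin m) :
    lssRestrict Q p L (lssColumn S1 S2 (L + 1) w j) = lssColumn S1 S2 L w j := rfl

theorem lssShift_lssColumn (L : ℕ) (q : Q) (w : List Q) (j : Φ ⊕ Q × Fin m) :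
    lssShift p L q (lssColumn S1 S2 (L + 1) w j) = lssColumn S1 S2 L (w ++ [q]) j := by
  funext ⟨⟨v, hv⟩, q', r⟩
  simp [lssShift, lssColumn, LinearMap.funLeft_apply]

theorem map_lssRestrict (L M : ℕ) :
    (lssColumnSpan S1 S2 (L + 1) M).map (lssRestrict Q p L) = lssColumnSpan S1 S2 L M := by
  rw [lssColumnSpan, lssColumnSpan, Submodule.map_span, ← Set.range_comp]
  rfl

/-- If adding the rows of length `L + 1` does not increase the rank, then columns can be
extended linearly to these rows. -/
theorem exists_lssColumn_extension [Finite Q] {L M : ℕ}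
    (h : lssHankelRank S1 S2 L M = lssHankelRank S1 S2 (L + 1) M) :
    ∃ g : ({v : List Q // v.length ≤ L} × Q × Fin p → ℝ) →ₗ[ℝ]
      ({v : List Q // v.length ≤ L + 1} × Q × Fin p → ℝ),
      ∀ w : List Q, w.length ≤ M → ∀ j, g (lssColumn S1 S2 L w j) = lssColumn S1 S2 (L + 1) w j := by
  have := finite_lssRows (Q := Q) (p := p) (L + 1)
  let f := (lssRestrict Q p L).domRestrict (lssColumnSpan S1 S2 (L + 1) M)
  have hf : LinearMap.ker f = ⊥ := by
    have hr := LinearMap.finrank_range_add_finrank_ker f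
    rw [LinearMap.range_domRestrict, map_lssRestrict] at hr
    change lssHankelRank S1 S2 L M + _ = lssHankelRank S1 S2 (L + 1) M at hr
    exact Submodule.finrank_eq_zero.1 (by omega)
  obtain ⟨g, hg⟩ := f.exists_leftInverse_of_injective hf
  refine ⟨Submodule.subtype _ ∘ₗ g, fun w hw j => ?_⟩
  exact congrArg Subtype.val
    (LinearMap.congr_fun hg ⟨_, lssColumn_mem_lssColumnSpan hw j⟩)

theorem lssColumnSpan_eq_succ [Finite Q] {L M : ℕ}
    (h : lssHankelRank S1 S2 L M = lssHankelRank S1 S2 L (M + 1)) :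
    lssColumnSpan S1 S2 L M = lssColumnSpan S1 S2 L (M + 1) := by
  have := finite_lssRows (Q := Q) (p := p) L
  exact Submodule.eq_of_le_of_finrank_eq
    (lssColumnSpan_induction fun w hw j => lssColumn_mem_lssColumnSpan (by omega) j) h

/-- Under the rank condition, the column space of `H_{Φ,N,N}` carries a
`(2N+1)`-partial realization. -/
theorem exists_isLssPartialRealization_of_rank_eq [Finite Q] {N : ℕ}
    (h1 : lssHankelRank S1 S2 N N = lssHankelRank S1 S2 (N + 1) N)
    (h2 : lssHankelRank S1 S2 N N = lssHankelRank S1 S2 N (N + 1)) :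
    ∃ (A : Q → Matrix (Fin (lssHankelRank S1 S2 N N)) (Fin (lssHankelRank S1 S2 N N)) ℝ)
      (B : Q → Matrix (Fin (lssHankelRank S1 S2 N N)) (Fin m) ℝ)
      (C : Q → Matrix (Fin p) (Fin (lssHankelRank S1 S2 N N)) ℝ)
      (μ : Φ → Fin (lssHankelRank S1 S2 N N) → ℝ),
      IsLssPartialRealization S1 S2 (2 * N + 1) A B C μ := by
  have := finite_lssRows (Q := Q) (p := p) N
  obtain ⟨g, hg⟩ := exists_lssColumn_extension h1
  let X := lssColumnSpan S1 S2 N N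
  let s (q : Q) := lssShift p N q ∘ₗ g
  have hs (q : Q) {w : List Q} (hw : w.length ≤ N) (j : Φ ⊕ Q × Fin m) :
      s q (lssColumn S1 S2 N w j) = lssColumn S1 S2 N (w ++ [q]) j := by
    simp only [s, LinearMap.comp_apply, hg w hw, lssShift_lssColumn]
  have hsX (q : Q) : ∀ x ∈ X, s q x ∈ X := by
    refine lssColumnSpan_induction (P := X.comap (s q)) fun w hw j => ?_
    rw [Submodule.mem_comap, hs q hw, show X = _ from lssColumnSpan_eq_succ h2]
    exact lssColumn_mem_lssColumnSpan (by simpa using hw) j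
  have hgX : ∀ x ∈ X, lssRestrict Q p N (g x) = x := by
    refine lssColumnSpan_induction
      (P := LinearMap.eqLocus (lssRestrict Q p N ∘ₗ g) LinearMap.id) fun w hw j => ?_
    simp [LinearMap.mem_eqLocus, hg w hw, lssRestrict_lssColumn]
  let a (q : Q) : X →ₗ[ℝ] X := (s q).restrict (hsX q)
  let c (q : Q) : X →ₗ[ℝ] Fin p → ℝ :=
    LinearMap.funLeft ℝ ℝ (fun r => (⟨[], N.zero_le⟩, q, r)) ∘ₗ X.subtype
  let b (j : Φ ⊕ Q × Fin m) : X := ⟨_, lssColumn_mem_lssColumnSpan (w := []) N.zero_le j⟩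
  have hb (w : List Q) (hw : w.length ≤ N + 1) (j : Φ ⊕ Q × Fin m) :
      (w.foldl (fun x q => a q x) (b j)).1 = lssColumn S1 S2 N w j := by
    induction w using List.reverseRecOn with
    | nil => rfl
    | append_singleton w q ih =>
      have hw' : w.length ≤ N := by simpa using hw
      rw [List.foldl_append, ← hs q hw', ← ih (by omega)]
      rfl
  have hc (v : List Q) (hv : v.length ≤ N) (q : Q) (r : Fin p) (x : X) :
      c q (v.foldl (fun x q => a q x) x) r = x.1 (⟨v, hv⟩, q, r) := by
    induction v generalizing x with
    | nil => rfl
    | cons q' v ih =>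
      rw [List.foldl_cons, ih ((Nat.le_succ _).trans hv)]
      conv_rhs => rw [← hgX x.1 x.2]
      rfl
  refine exists_isLssPartialRealization_of_linearMap (V := X) a c b fun u hu j q => ?_
  funext r
  have hw : (u.take (N + 1)).length ≤ N + 1 := List.length_take_le _ _
  have hv : (u.drop (N + 1)).length ≤ N := by rw [List.length_drop]; omega
  conv_rhs => rw [← List.take_append_drop (N + 1) u]
  rw [List.foldl_append, hc _ hv, hb _ hw]
  simp [lssColumn]

end LssRealization

/-- under the rank condition, (1) a minimal `(2N+1)`-partial LSS
realization of the Markov data exists; (2) every minimal `(2N+1)`-partial realization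
has dimension `rank H_{Φ,N,N}`; (3) any two minimal `(2N+1)`-partial realizations are
LSS-isomorphic. -/
theorem stmt18 {Q Φ : Type*} [Fintype Q] {p m : ℕ}
    (S1 : Q → Q → Fin m → List Q → Fin p → ℝ)
    (S2 : Φ → Q → List Q → Fin p → ℝ)
    (N : ℕ) (hN : 0 < N)
    (h1 : lssHankelRank S1 S2 N N = lssHankelRank S1 S2 (N + 1) N)
    (h2 : lssHankelRank S1 S2 N N = lssHankelRank S1 S2 N (N + 1)) :
    (∃ (n : ℕ) (A : Q → Matrix (Fin n) (Fin n) ℝ) (B : Q → Matrix (Fin n) (Fin m) ℝ)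
       (C : Q → Matrix (Fin p) (Fin n) ℝ) (μ : Φ → Fin n → ℝ),
       IsLssPartialRealization S1 S2 (2 * N + 1) A B C μ ∧
       (∀ (n' : ℕ) (A' : Q → Matrix (Fin n') (Fin n') ℝ)
          (B' : Q → Matrix (Fin n') (Fin m) ℝ) (C' : Q → Matrix (Fin p) (Fin n') ℝ)
          (μ' : Φ → Fin n' → ℝ),
          IsLssPartialRealization S1 S2 (2 * N + 1) A' B' C' μ' → n ≤ n')) ∧
    (∀ (n : ℕ) (A : Q → Matrix (Fin n) (Fin n) ℝ) (B : Q → Matrix (Fin n) (Fin m) ℝ)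
       (C : Q → Matrix (Fin p) (Fin n) ℝ) (μ : Φ → Fin n → ℝ),
       IsLssPartialRealization S1 S2 (2 * N + 1) A B C μ →
       (∀ (n' : ℕ) (A' : Q → Matrix (Fin n') (Fin n') ℝ)
          (B' : Q → Matrix (Fin n') (Fin m) ℝ) (C' : Q → Matrix (Fin p) (Fin n') ℝ)
          (μ' : Φ → Fin n' → ℝ),
          IsLssPartialRealization S1 S2 (2 * N + 1) A' B' C' μ' → n ≤ n') →
       n = lssHankelRank S1 S2 N N) ∧
    (∀ (n n' : ℕ) (A : Q → Matrix (Fin n) (Fin n) ℝ) (B : Q → Matrix (Fin n) (Fin m) ℝ)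
       (C : Q → Matrix (Fin p) (Fin n) ℝ) (μ : Φ → Fin n → ℝ)
       (A' : Q → Matrix (Fin n') (Fin n') ℝ) (B' : Q → Matrix (Fin n') (Fin m) ℝ)
       (C' : Q → Matrix (Fin p) (Fin n') ℝ) (μ' : Φ → Fin n' → ℝ),
       IsLssPartialRealization S1 S2 (2 * N + 1) A B C μ →
       IsLssPartialRealization S1 S2 (2 * N + 1) A' B' C' μ' →
       (∀ (n'' : ℕ) (A'' : Q → Matrix (Fin n'') (Fin n'') ℝ)
          (B'' : Q → Matrix (Fin n'') (Fin m) ℝ) (C'' : Q → Matrix (Fin p) (Fin n'') ℝ)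
          (μ'' : Φ → Fin n'' → ℝ),
          IsLssPartialRealization S1 S2 (2 * N + 1) A'' B'' C'' μ'' → n ≤ n'') →
       (∀ (n'' : ℕ) (A'' : Q → Matrix (Fin n'') (Fin n'') ℝ)
          (B'' : Q → Matrix (Fin n'') (Fin m) ℝ) (C'' : Q → Matrix (Fin p) (Fin n'') ℝ)
          (μ'' : Φ → Fin n'' → ℝ),
          IsLssPartialRealization S1 S2 (2 * N + 1) A'' B'' C'' μ'' → n' ≤ n'') →
       ∃ T : Matrix (Fin n') (Fin n) ℝ, IsLssIso A B C μ A' B' C' μ' T) := by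
  obtain ⟨A₀, B₀, C₀, μ₀, h₀⟩ := exists_isLssPartialRealization_of_rank_eq h1 h2
  have hK : N + N ≤ 2 * N + 1 := by omega
  have hdim (n : ℕ) (A : Q → Matrix (Fin n) (Fin n) ℝ) (B : Q → Matrix (Fin n) (Fin m) ℝ)
      (C : Q → Matrix (Fin p) (Fin n) ℝ) (μ : Φ → Fin n → ℝ)
      (h : IsLssPartialRealization S1 S2 (2 * N + 1) A B C μ)
      (hmin : ∀ (n' : ℕ) (A' : Q → Matrix (Fin n') (Fin n') ℝ)
          (B' : Q → Matrix (Fin n') (Fin m) ℝ) (C' : Q → Matrix (Fin p) (Fin n') ℝ)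
          (μ' : Φ → Fin n' → ℝ),
          IsLssPartialRealization S1 S2 (2 * N + 1) A' B' C' μ' → n ≤ n') :
      n = lssHankelRank S1 S2 N N :=
    le_antisymm (hmin _ _ _ _ _ h₀) (h.lssHankelRank_le hK)
  exact ⟨⟨_, A₀, B₀, C₀, μ₀, h₀, fun _ _ _ _ _ h => h.lssHankelRank_le hK⟩, hdim,
    fun n n' A B C μ A' B' C' μ' h h' hmin hmin' =>
      h.exists_isLssIso h' (hdim n A B C μ h hmin) (hdim n' A' B' C' μ' h' hmin')⟩
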